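/- Let K ⊂ (-1,0) be a compact set. Then there exists an integer N ≥ 3 such that for every q ∈ K the split reliability polynomial S_N(q) is nonzero and the virtual edge interaction satisfies ŷ_N(q) < -1. -/

import Mathlib

open SimpleGraph Finset

noncomputable section

/-- The finset of edges of a simple graph on a finite vertex type. -/
def edgeFin {V : Type} [Finite V] (G : SimpleGraph V) : Finset (Sym2 V) :=
  (Set.toFinite G.edgeSet).toFinset

open Classical in
/-- All-terminal reliability polynomial: `relPoly G q` is the probability that the graph stays
connected when every edge fails independently with probability `q`. -/
def relPoly {V : Type} [Finite V] (G : SimpleGraph V) (q : ℝ) : ℝ :=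
  ∑ A ∈ (edgeFin G).powerset,
    if (SimpleGraph.fromEdgeSet (A : Set (Sym2 V))).Connected then
      (1 - q) ^ A.card * q ^ ((edgeFin G).card - A.card) else 0

open Classical in
/-- Split reliability polynomial with terminals `u`, `v`: the sum is over edge subsets whose
spanning subgraph has exactly two components, one containing `u` and the other containing `v`. -/
def splitRel {V : Type} [Finite V] (H : SimpleGraph V) (u v : V) (q : ℝ) : ℝ :=
  ∑ A ∈ (edgeFin H).powerset,
    if (¬ (SimpleGraph.fromEdgeSet (A : Set (Sym2 V))).Reachable u v ∧
        ∀ w, (SimpleGraph.fromEdgeSet (A : Set (Sym2 V))).Reachable u w ∨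
             (SimpleGraph.fromEdgeSet (A : Set (Sym2 V))).Reachable v w) then
      (1 - q) ^ A.card * q ^ ((edgeFin H).card - A.card) else 0

/-- The virtual edge interaction `ŷ_H = Rel(H)/S(H) + 1`. -/
def yhat {V : Type} [Finite V] (H : SimpleGraph V) (u v : V) (q : ℝ) : ℝ :=
  relPoly H q / splitRel H u v q + 1

/-- `Hgraph n` is the complete graph on `Fin n` with the edge between `0` and `1` removed
(for `n ≥ 2`; for `n < 2` no edge is removed). -/
def Hgraph (n : ℕ) : SimpleGraph (Fin n) :=
  (⊤ : SimpleGraph (Fin n)).deleteEdges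
    {e | ∃ _h : 2 ≤ n, e = s(⟨0, by omega⟩, ⟨1, by omega⟩)}

/-- `Cfun n q = Rel(K_n; q)`. -/
def Cfun (n : ℕ) (q : ℝ) : ℝ := relPoly (⊤ : SimpleGraph (Fin n)) q

/-- `Rfun n q = Rel(H_n; q)` where `H_n = K_n` minus an edge. -/
def Rfun (n : ℕ) (q : ℝ) : ℝ := relPoly (Hgraph n) q

/-- `Sfun n q = S(H_n; q)`, the split reliability of `K_n` minus the edge `uv`,
with terminals `u`, `v` the endpoints of the deleted edge. -/
def Sfun (n : ℕ) (q : ℝ) : ℝ :=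
  if h : 2 ≤ n then splitRel (Hgraph n) ⟨0, by omega⟩ ⟨1, by omega⟩ q else 0

/-- `yfun n q = ŷ_{H_n}(q)`. -/
def yfun (n : ℕ) (q : ℝ) : ℝ := Rfun n q / Sfun n q + 1

/-- The sum over `A ⊆ E` with property `P` of `(1 - q) ^ |A| * q ^ (|E| - |A|)`. -/
def edgeSum {α : Type} (q : ℝ) (E : Finset α) (P : Finset α → Prop) : ℝ :=
  open Classical in
  ∑ A ∈ E.powerset with P A, (1 - q) ^ A.card * q ^ (E.card - A.card)

/-- The non-loop edges with both endpoints in `U`. -/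
def edgesIn {V : Type} (U : Finset V) : Finset (Sym2 V) :=
  open Classical in U.sym2.filter (fun e => ¬ e.IsDiag)

/-- All vertices of `U` are mutually reachable through the edges in `A`. -/
def Joins {V : Type} (A : Finset (Sym2 V)) (U : Finset V) : Prop :=
  ∀ x ∈ U, ∀ y ∈ U, (fromEdgeSet (A : Set (Sym2 V))).Reachable x y

/-- The two-component condition in the definition of `splitRel`. -/
def Splits {V : Type} (A : Finset (Sym2 V)) (u v : V) : Prop :=
  ¬ (fromEdgeSet (A : Set (Sym2 V))).Reachable u v ∧
    ∀ w, (fromEdgeSet (A : Set (Sym2 V))).Reachable u w ∨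
      (fromEdgeSet (A : Set (Sym2 V))).Reachable v w

lemma relPoly_eq_edgeSum {V : Type} [Finite V] (G : SimpleGraph V) (q : ℝ) :
    relPoly G q = edgeSum q (edgeFin G)
      (fun A => (fromEdgeSet (A : Set (Sym2 V))).Connected) := by
  classical
  rw [relPoly, edgeSum, Finset.sum_filter]

lemma splitRel_eq_edgeSum {V : Type} [Finite V] (H : SimpleGraph V) (u v : V) (q : ℝ) :
    splitRel H u v q = edgeSum q (edgeFin H) (fun A => Splits A u v) := by
  classical
  rw [splitRel, edgeSum, Finset.sum_filter]
  exact Finset.sum_congr rfl fun A _ => if_congr Iff.rfl rfl rfl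

lemma edgeSum_congr {α : Type} {q : ℝ} {E : Finset α} {P Q : Finset α → Prop}
    (h : ∀ A ⊆ E, (P A ↔ Q A)) : edgeSum q E P = edgeSum q E Q := by
  classical
  unfold edgeSum
  congr 1
  apply Finset.filter_congr
  intro A hA
  exact h A (Finset.mem_powerset.1 hA)

lemma edgeSum_true {α : Type} (q : ℝ) (E : Finset α) : edgeSum q E (fun _ => True) = 1 := by
  simp [edgeSum, Finset.sum_pow_mul_eq_add_pow]

lemma edgeSum_eq_mul {α : Type} [DecidableEq α] {q : ℝ} {E E₁ E₂ : Finset α}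
    {P P₁ P₂ : Finset α → Prop}
    (hd : Disjoint E₁ E₂) (hE : E₁ ∪ E₂ ⊆ E)
    (hP : ∀ A ⊆ E, (P A ↔ A ⊆ E₁ ∪ E₂ ∧ P₁ (A ∩ E₁) ∧ P₂ (A ∩ E₂))) :
    edgeSum q E P =
      edgeSum q E₁ P₁ * edgeSum q E₂ P₂ * q ^ (E.card - (E₁.card + E₂.card)) := by
  classical
  unfold edgeSum
  rw [Finset.sum_mul_sum, ← Finset.sum_product', Finset.sum_mul]
  have key₁ : ∀ A₁ ⊆ E₁, ∀ A₂ ⊆ E₂, (A₁ ∪ A₂) ∩ E₁ = A₁ := by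
    intro A₁ h₁ A₂ h₂
    rw [union_inter_distrib_right, inter_eq_left.2 h₁,
      disjoint_iff_inter_eq_empty.1 (hd.symm.mono_left h₂), union_empty]
  have key₂ : ∀ A₁ ⊆ E₁, ∀ A₂ ⊆ E₂, (A₁ ∪ A₂) ∩ E₂ = A₂ := by
    intro A₁ h₁ A₂ h₂
    rw [union_inter_distrib_right, inter_eq_left.2 h₂,
      disjoint_iff_inter_eq_empty.1 (hd.mono_left h₁), empty_union]
  refine Finset.sum_nbij' (fun A => (A ∩ E₁, A ∩ E₂)) (fun B => B.1 ∪ B.2) ?_ ?_ ?_ ?_ ?_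
  · intro A hA
    simp only [mem_filter, mem_powerset, mem_product] at hA ⊢
    have := (hP A hA.1).1 hA.2
    exact ⟨⟨inter_subset_right, this.2.1⟩, inter_subset_right, this.2.2⟩
  · rintro ⟨A₁, A₂⟩ hA
    simp only [mem_filter, mem_powerset, mem_product] at hA ⊢
    obtain ⟨⟨h₁, p₁⟩, h₂, p₂⟩ := hA
    have hs := union_subset_union h₁ h₂
    refine ⟨hs.trans hE, (hP _ (hs.trans hE)).2 ⟨hs, ?_⟩⟩
    rw [key₁ _ h₁ _ h₂, key₂ _ h₁ _ h₂]
    exact ⟨p₁, p₂⟩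
  · intro A hA
    simp only [mem_filter, mem_powerset] at hA
    have := (hP A hA.1).1 hA.2
    simp only
    rw [← inter_union_distrib_left, inter_eq_left.2 this.1]
  · rintro ⟨A₁, A₂⟩ hA
    simp only [mem_filter, mem_powerset, mem_product] at hA
    obtain ⟨⟨h₁, p₁⟩, h₂, p₂⟩ := hA
    simp only [key₁ _ h₁ _ h₂, key₂ _ h₁ _ h₂]
  · intro A hA
    simp only [mem_filter, mem_powerset] at hA
    have hs := ((hP A hA.1).1 hA.2).1
    have hc : A.card = (A ∩ E₁).card + (A ∩ E₂).card := by
      rw [← card_union_of_disjoint (hd.mono inter_subset_right inter_subset_right),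
        ← inter_union_distrib_left, inter_eq_left.2 hs]
    have h₁ := card_le_card (inter_subset_right : A ∩ E₁ ⊆ E₁)
    have h₂ := card_le_card (inter_subset_right : A ∩ E₂ ⊆ E₂)
    have h₃ := card_le_card hE
    rw [card_union_of_disjoint hd] at h₃
    have hq : E.card - A.card = (E₁.card - (A ∩ E₁).card) + (E₂.card - (A ∩ E₂).card) +
        (E.card - (E₁.card + E₂.card)) := by omega
    simp only
    rw [hq, hc]
    ring

lemma edgeSum_map {α β : Type} (f : α ↪ β) (q : ℝ) (E : Finset α) (P : Finset β → Prop) :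
    edgeSum q (E.map f) P = edgeSum q E (fun A => P (A.map f)) := by
  classical
  unfold edgeSum
  rw [Finset.sum_filter, Finset.sum_filter]
  have : (E.map f).powerset = E.powerset.map (mapEmbedding f).toEmbedding := by
    ext A
    simp [subset_map_iff, eq_comm]
  rw [this, sum_map]
  simp

lemma mk_mem_edgesIn {V : Type} {U : Finset V} {x y : V} :
    s(x, y) ∈ edgesIn U ↔ x ∈ U ∧ y ∈ U ∧ x ≠ y := by
  simp [edgesIn, and_assoc]

lemma card_edgesIn {V : Type} (U : Finset V) : (edgesIn U).card = U.card.choose 2 := by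
  classical
  rw [← Sym2.card_image_offDiag]
  congr 1
  ext e
  induction e with
  | _ x y =>
    rw [mk_mem_edgesIn]
    simp only [mem_image, mem_offDiag, Prod.exists, Function.uncurry_apply_pair, Sym2.eq_iff]
    constructor
    · rintro ⟨hx, hy, hxy⟩
      exact ⟨x, y, ⟨hx, hy, hxy⟩, Or.inl ⟨rfl, rfl⟩⟩
    · rintro ⟨a, b, ⟨ha, hb, hab⟩, ⟨rfl, rfl⟩ | ⟨rfl, rfl⟩⟩
      · exact ⟨ha, hb, hab⟩
      · exact ⟨hb, ha, hab.symm⟩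

lemma edgesIn_mono {V : Type} {U W : Finset V} (h : U ⊆ W) : edgesIn U ⊆ edgesIn W := by
  intro e
  induction e with
  | _ x y =>
    simp only [mk_mem_edgesIn]
    exact fun ⟨hx, hy, hxy⟩ => ⟨h hx, h hy, hxy⟩

lemma disjoint_edgesIn {V : Type} {U W : Finset V} (h : Disjoint U W) :
    Disjoint (edgesIn U) (edgesIn W) := by
  rw [Finset.disjoint_left]
  intro e
  induction e with
  | _ x y =>
    simp only [mk_mem_edgesIn]
    exact fun ⟨hx, _, _⟩ ⟨hx', _, _⟩ => Finset.disjoint_left.1 h hx hx'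

lemma edgesIn_map {V W : Type} (f : V ↪ W) (U : Finset V) :
    edgesIn (U.map f) = (edgesIn U).map f.sym2Map := by
  ext e
  induction e with
  | _ x y =>
    simp only [mk_mem_edgesIn, mem_map]
    constructor
    · rintro ⟨⟨a, ha, rfl⟩, ⟨b, hb, rfl⟩, hab⟩
      exact ⟨s(a, b), mk_mem_edgesIn.2 ⟨ha, hb, fun h => hab (by rw [h])⟩, rfl⟩
    · rintro ⟨e, he, h⟩
      induction e with
      | _ a b =>
        rw [mk_mem_edgesIn] at he
        simp only [Function.Embedding.sym2Map_apply, Sym2.map_mk, Sym2.eq_iff] at h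
        rcases h with ⟨rfl, rfl⟩ | ⟨rfl, rfl⟩
        · exact ⟨⟨a, he.1, rfl⟩, ⟨b, he.2.1, rfl⟩, f.injective.ne he.2.2⟩
        · exact ⟨⟨b, he.2.1, rfl⟩, ⟨a, he.1, rfl⟩, f.injective.ne he.2.2.symm⟩

lemma edgeFin_top {V : Type} [Fintype V] : edgeFin (⊤ : SimpleGraph V) = edgesIn univ := by
  ext e
  induction e with
  | _ x y => simp [edgeFin, mk_mem_edgesIn]

lemma reachable_map_iff {V W : Type} (f : V ↪ W) (A : Finset (Sym2 V)) (x y : V) :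
    (fromEdgeSet (A.map f.sym2Map : Set (Sym2 W))).Reachable (f x) (f y) ↔
      (fromEdgeSet (A : Set (Sym2 V))).Reachable x y := by
  have hadj : ∀ a b, (fromEdgeSet (A : Set (Sym2 V))).Adj a b →
      (fromEdgeSet (A.map f.sym2Map : Set (Sym2 W))).Adj (f a) (f b) := by
    intro a b h
    rw [fromEdgeSet_adj] at h ⊢
    exact ⟨mem_coe.2 (mem_map.2 ⟨s(a, b), h.1, rfl⟩), f.injective.ne h.2⟩
  constructor
  · intro h
    rw [reachable_iff_reflTransGen] at h
    have : ∀ z, Relation.ReflTransGen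
        (fromEdgeSet (A.map f.sym2Map : Set (Sym2 W))).Adj (f x) z →
        ∃ b, z = f b ∧ (fromEdgeSet (A : Set (Sym2 V))).Reachable x b := by
      intro z hz
      induction hz with
      | refl => exact ⟨x, rfl, Reachable.refl x⟩
      | tail _ hbc ih =>
        obtain ⟨b, rfl, hb⟩ := ih
        rw [fromEdgeSet_adj] at hbc
        obtain ⟨hm, hne⟩ := hbc
        obtain ⟨e, he, h⟩ := mem_map.1 (mem_coe.1 hm)
        have step : ∀ c, s(b, c) ∈ A → f b ≠ f c →
            (fromEdgeSet (A : Set (Sym2 V))).Reachable x c := fun c hc hn =>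
          hb.trans (Adj.reachable ((fromEdgeSet_adj _).2 ⟨hc, fun h => hn (by rw [h])⟩))
        induction e with
        | _ a c =>
          simp only [Function.Embedding.sym2Map_apply, Sym2.map_mk, Sym2.eq_iff] at h
          rcases h with ⟨h₁, rfl⟩ | ⟨rfl, h₂⟩
          · obtain rfl := f.injective h₁
            exact ⟨c, rfl, step c he hne⟩
          · obtain rfl := f.injective h₂
            exact ⟨a, rfl, step a (Sym2.eq_swap ▸ he) hne⟩
    obtain ⟨b, hb, h⟩ := this _ h
    exact f.injective hb ▸ h
  · exact fun h => h.map ⟨f, fun {a b} => hadj a b⟩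

lemma edgeSum_joins_map {V W : Type} (f : V ↪ W) (q : ℝ) (U : Finset V) :
    edgeSum q (edgesIn (U.map f)) (fun A => Joins A (U.map f)) =
      edgeSum q (edgesIn U) (fun A => Joins A U) := by
  rw [edgesIn_map, edgeSum_map]
  refine edgeSum_congr fun A _ => ?_
  simp only [Joins, mem_map, forall_exists_index, and_imp, forall_apply_eq_imp_iff₂,
    reachable_map_iff]

lemma joins_univ_iff {V : Type} [Fintype V] [Nonempty V] (A : Finset (Sym2 V)) :
    Joins A univ ↔ (fromEdgeSet (A : Set (Sym2 V))).Connected := by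
  simp [Joins, connected_iff, Preconnected, *]

lemma edgeSum_joins {V : Type} (q : ℝ) {U : Finset V} (hU : U.Nonempty) :
    edgeSum q (edgesIn U) (fun A => Joins A U) = Cfun U.card q := by
  have : Nonempty (Fin U.card) := ⟨⟨0, hU.card_pos⟩⟩
  have hmap : (univ : Finset (Fin U.card)).map
      (U.equivFin.symm.toEmbedding.trans (Function.Embedding.subtype _)) = U := by
    ext x
    simp only [mem_map, mem_univ, true_and]
    constructor
    · rintro ⟨i, rfl⟩
      exact (U.equivFin.symm i).2
    · exact fun hx => ⟨U.equivFin ⟨x, hx⟩, by simp⟩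
  rw [Cfun, relPoly_eq_edgeSum, edgeFin_top]
  conv_lhs => rw [← hmap]
  rw [edgeSum_joins_map]
  exact edgeSum_congr fun A _ => joins_univ_iff A

lemma reachable_inter_of_reachable {V : Type} [DecidableEq V] {A : Finset (Sym2 V)}
    {U : Finset V}
    (hA : ∀ x y, s(x, y) ∈ A → x ≠ y → x ∈ U → y ∈ U) {x y : V} (hx : x ∈ U)
    (h : (fromEdgeSet (A : Set (Sym2 V))).Reachable x y) :
    y ∈ U ∧ (fromEdgeSet (A ∩ edgesIn U : Finset (Sym2 V)) : SimpleGraph V).Reachable x y := by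
  rw [reachable_iff_reflTransGen] at h
  induction h with
  | refl => exact ⟨hx, Reachable.refl x⟩
  | @tail b c _ hbc ih =>
    rw [fromEdgeSet_adj] at hbc
    have hc := hA b c hbc.1 hbc.2 ih.1
    refine ⟨hc, ih.2.trans (Adj.reachable ((fromEdgeSet_adj _).2 ⟨?_, hbc.2⟩))⟩
    exact mem_coe.2 (mem_inter.2 ⟨hbc.1, mk_mem_edgesIn.2 ⟨ih.1, hc, hbc.2⟩⟩)

lemma mem_of_subset_union {V : Type} [Fintype V] [DecidableEq V] {A : Finset (Sym2 V)}
    {U : Finset V} (hA : A ⊆ edgesIn U ∪ edgesIn Uᶜ) (x y : V) (h : s(x, y) ∈ A) :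
    x ∈ U ↔ y ∈ U := by
  have := hA h
  simp only [mem_union, mk_mem_edgesIn, mem_compl] at this
  tauto

lemma reachable_of_inter {V : Type} [DecidableEq V] {A B : Finset (Sym2 V)} {x y : V}
    (h : (fromEdgeSet (A ∩ B : Finset (Sym2 V)) : SimpleGraph V).Reachable x y) :
    (fromEdgeSet (A : Set (Sym2 V))).Reachable x y :=
  h.mono (fromEdgeSet_mono (coe_subset.2 inter_subset_left))

lemma component_eq_iff {V : Type} [Fintype V] [DecidableEq V] {A : Finset (Sym2 V)}
    {U : Finset V} {u : V} (hu : u ∈ U) (hA : A ⊆ edgesIn univ) :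
    (∀ x, (fromEdgeSet (A : Set (Sym2 V))).Reachable u x ↔ x ∈ U) ↔
      A ⊆ edgesIn U ∪ edgesIn Uᶜ ∧ Joins (A ∩ edgesIn U) U := by
  constructor
  · intro h
    have hc : ∀ x y, s(x, y) ∈ A → x ≠ y → x ∈ U → y ∈ U := fun x y hxy hne hx =>
      (h y).1 (((h x).2 hx).trans (Adj.reachable ((fromEdgeSet_adj _).2 ⟨hxy, hne⟩)))
    refine ⟨fun e => ?_, fun x hx y hy => ?_⟩
    · induction e with
      | _ x y =>
        intro he
        have hne := (mk_mem_edgesIn.1 (hA he)).2.2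
        have h₁ := hc x y he hne
        have h₂ := hc y x (Sym2.eq_swap ▸ he) hne.symm
        simp only [mem_union, mk_mem_edgesIn, mem_compl]
        tauto
    · exact (reachable_inter_of_reachable hc hx (((h x).2 hx).symm.trans ((h y).2 hy))).2
  · rintro ⟨hs, hj⟩ x
    exact ⟨fun h => (reachable_inter_of_reachable
        (fun x y hxy _ => (mem_of_subset_union hs x y hxy).1) hu h).1,
      fun hx => reachable_of_inter (hj u hu x hx)⟩

lemma splits_component_eq_iff {V : Type} [Fintype V] [DecidableEq V] {A : Finset (Sym2 V)}
    {U : Finset V} {u v : V} (hu : u ∈ U) (hv : v ∉ U) (hA : A ⊆ edgesIn univ) :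
    (Splits A u v ∧ ∀ x, (fromEdgeSet (A : Set (Sym2 V))).Reachable u x ↔ x ∈ U) ↔
      A ⊆ edgesIn U ∪ edgesIn Uᶜ ∧
        Joins (A ∩ edgesIn U) U ∧ Joins (A ∩ edgesIn Uᶜ) Uᶜ := by
  rw [component_eq_iff hu hA]
  constructor
  · rintro ⟨hsp, hs, hj⟩
    have hcomp := (component_eq_iff hu hA).2 ⟨hs, hj⟩
    have hv' : ∀ x ∈ Uᶜ, (fromEdgeSet (A : Set (Sym2 V))).Reachable v x := fun x hx =>
      (hsp.2 x).resolve_left fun h => mem_compl.1 hx ((hcomp x).1 h)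
    refine ⟨hs, hj, fun x hx y hy => ?_⟩
    refine (reachable_inter_of_reachable (fun x y hxy _ hx => ?_) hx
      ((hv' x hx).symm.trans (hv' y hy))).2
    rw [mem_compl] at hx ⊢
    exact fun hy => hx ((mem_of_subset_union hs x y hxy).2 hy)
  · rintro ⟨hs, hj, hj'⟩
    have hcomp := (component_eq_iff hu hA).2 ⟨hs, hj⟩
    refine ⟨⟨fun h => hv ((hcomp v).1 h), fun w => ?_⟩, hs, hj⟩
    by_cases hw : w ∈ U
    · exact Or.inl ((hcomp w).2 hw)
    · exact Or.inr (reachable_of_inter (hj' v (mem_compl.2 hv) w (mem_compl.2 hw)))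

lemma edgeSum_insert {α : Type} [DecidableEq α] {q : ℝ} {E : Finset α} {a : α} (ha : a ∉ E)
    (P : Finset α → Prop) :
    edgeSum q (insert a E) P =
      q * edgeSum q E P + (1 - q) * edgeSum q E (fun A => P (insert a A)) := by
  classical
  unfold edgeSum
  simp only [Finset.sum_filter]
  rw [sum_powerset_insert ha, mul_sum, mul_sum]
  congr 1 <;> refine Finset.sum_congr rfl fun A hA => ?_
  · rw [mul_ite, mul_zero]
    refine if_congr Iff.rfl ?_ rfl
    have := card_le_card (mem_powerset.1 hA)
    rw [card_insert_of_notMem ha, Nat.succ_sub this, pow_succ]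
    ring
  · rw [mul_ite, mul_zero]
    refine if_congr Iff.rfl ?_ rfl
    rw [card_insert_of_notMem ha, card_insert_of_notMem fun h => ha (mem_powerset.1 hA h),
      Nat.add_sub_add_right, pow_succ]
    ring

lemma edgeSum_or {α : Type} {q : ℝ} {E : Finset α} {P Q : Finset α → Prop}
    (h : ∀ A, P A → ¬ Q A) :
    edgeSum q E (fun A => P A ∨ Q A) = edgeSum q E P + edgeSum q E Q := by
  classical
  unfold edgeSum
  simp only [Finset.sum_filter, ← Finset.sum_add_distrib]
  refine Finset.sum_congr rfl fun A _ => ?_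
  have := h A
  by_cases hA : P A <;> simp_all

lemma edgeSum_eq_sum_component {V : Type} [DecidableEq V] {q : ℝ} {E : Finset (Sym2 V)}
    {P : Finset (Sym2 V) → Prop} {u : V} {T : Finset V} (hu : u ∉ T)
    (h : ∀ A, P A → ∀ x, (fromEdgeSet (A : Set (Sym2 V))).Reachable u x → x ∈ insert u T) :
    edgeSum q E P = ∑ W ∈ T.powerset, edgeSum q E (fun A => P A ∧
      ∀ x, (fromEdgeSet (A : Set (Sym2 V))).Reachable u x ↔ x ∈ insert u W) := by
  classical
  unfold edgeSum
  rw [← sum_fiberwise_of_maps_to (t := T.powerset)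
    (g := fun A : Finset (Sym2 V) => T.filter fun x => (fromEdgeSet (A : Set (Sym2 V))).Reachable u x)
    (fun A _ => mem_powerset.2 (filter_subset _ _))
    (fun A : Finset (Sym2 V) => (1 - q) ^ A.card * q ^ (E.card - A.card))]
  refine Finset.sum_congr rfl fun W hW => ?_
  rw [filter_filter]
  refine Finset.sum_congr ?_ fun _ _ => rfl
  ext A
  simp only [mem_filter]
  refine and_congr_right fun _ => and_congr_right fun hP => ?_
  rw [mem_powerset] at hW
  constructor
  · rintro rfl x
    rw [mem_insert, mem_filter]
    constructor
    · exact fun hx => (mem_insert.1 (h A hP x hx)).imp_right fun hT => ⟨hT, hx⟩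
    · rintro (rfl | hx)
      · exact Reachable.refl _
      · exact hx.2
  · intro hr
    ext x
    rw [mem_filter, hr, mem_insert]
    constructor
    · rintro ⟨hT, rfl | hx⟩
      · exact absurd hT hu
      · exact hx
    · exact fun hx => ⟨hW hx, Or.inr hx⟩

lemma add_choose_two (a b : ℕ) : (a + b).choose 2 = a.choose 2 + b.choose 2 + a * b := by
  induction b with
  | zero => simp
  | succ b ih =>
    rw [← add_assoc, Nat.choose_succ_succ' (a + b) 1, Nat.choose_succ_succ' b 1, ih]
    simp only [Nat.choose_one_right]
    ring

lemma edgesIn_union_compl_subset {V : Type} [Fintype V] [DecidableEq V] (U : Finset V) :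
    edgesIn U ∪ edgesIn Uᶜ ⊆ edgesIn univ :=
  union_subset (edgesIn_mono (subset_univ _)) (edgesIn_mono (subset_univ _))

/-- Conditioning on the component of a fixed vertex of `K_{m+1}`. -/
lemma sum_choose_mul_Cfun (m : ℕ) (q : ℝ) :
    ∑ j ∈ range (m + 1), (m.choose j : ℝ) * (Cfun (j + 1) q * q ^ ((j + 1) * (m - j))) = 1 := by
  rw [← edgeSum_true q (edgesIn (univ : Finset (Fin (m + 1)))),
    edgeSum_eq_sum_component (u := 0) (T := univ.erase 0) (by simp) (by simp)]
  have hcard : (univ.erase (0 : Fin (m + 1))).card = m := by simp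
  have hsum := sum_powerset_apply_card
    (fun j => Cfun (j + 1) q * q ^ ((j + 1) * (m - j))) (x := univ.erase (0 : Fin (m + 1)))
  rw [hcard] at hsum
  simp only [nsmul_eq_mul] at hsum
  rw [← hsum]
  refine Finset.sum_congr rfl fun W hW => ?_
  have h0 : (0 : Fin (m + 1)) ∉ W := fun h => by simpa using mem_powerset.1 hW h
  have hWm := card_le_card (mem_powerset.1 hW)
  rw [hcard] at hWm
  have hins : (insert 0 W).card = W.card + 1 := card_insert_of_notMem h0
  have hcompl : (insert 0 W)ᶜ.card = m - W.card := by
    rw [card_compl, hins, Fintype.card_fin]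
    omega
  rw [edgeSum_eq_mul (P₁ := fun A => Joins A (insert 0 W)) (P₂ := fun _ => True)
    (disjoint_edgesIn disjoint_compl_right) (edgesIn_union_compl_subset (insert 0 W)),
    edgeSum_joins q (insert_nonempty _ _), edgeSum_true, mul_one]
  · congr 2
    · rw [hins]
    · simp only [card_edgesIn, hins, hcompl, card_univ, Fintype.card_fin]
      have := add_choose_two (W.card + 1) (m - W.card)
      rw [show W.card + 1 + (m - W.card) = m + 1 by omega] at this
      omega
  · intro A hA
    rw [true_and, and_true]
    exact component_eq_iff (mem_insert_self _ _) hA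

lemma edgeFin_Hgraph (m : ℕ) :
    edgeFin (Hgraph (m + 2)) = (edgesIn univ).erase s(0, 1) := by
  ext e
  rw [← edgeFin_top]
  simp [edgeFin, Hgraph, and_comm]

lemma Sfun_eq_edgeSum (m : ℕ) (q : ℝ) :
    Sfun (m + 2) q = edgeSum q ((edgesIn univ).erase s((0 : Fin (m + 2)), 1))
      (fun A => Splits A 0 1) := by
  rw [Sfun, dif_pos (by omega), splitRel_eq_edgeSum, edgeFin_Hgraph]
  rfl

/-- The split reliability of `K_{m+2}` minus an edge in terms of the reliabilities of the two
complete graphs joined by the cut. -/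
lemma Sfun_eq_sum (m : ℕ) (q : ℝ) :
    Sfun (m + 2) q = ∑ j ∈ range (m + 1), (m.choose j : ℝ) *
      (Cfun (j + 1) q * Cfun (m + 1 - j) q * q ^ ((j + 1) * (m + 1 - j) - 1)) := by
  rw [Sfun_eq_edgeSum, edgeSum_eq_sum_component (u := 0) (T := (univ.erase 0).erase 1)
    (by simp)]
  swap
  · intro A hA x hx
    simp only [mem_insert, mem_erase, mem_univ, and_true]
    by_cases h : x = 0
    · exact Or.inl h
    · refine Or.inr ⟨?_, h⟩
      rintro rfl
      exact hA.1 hx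
  have hcard : ((univ.erase (0 : Fin (m + 2))).erase 1).card = m := by
    rw [card_erase_of_mem (by simp), card_erase_of_mem (by simp)]
    simp
  have hsum := sum_powerset_apply_card
    (fun j => Cfun (j + 1) q * Cfun (m + 1 - j) q * q ^ ((j + 1) * (m + 1 - j) - 1))
    (x := (univ.erase (0 : Fin (m + 2))).erase 1)
  rw [hcard] at hsum
  simp only [nsmul_eq_mul] at hsum
  rw [← hsum]
  refine Finset.sum_congr rfl fun W hW => ?_
  have h0 : (0 : Fin (m + 2)) ∉ W := fun h => by simpa using mem_powerset.1 hW h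
  have h1 : (1 : Fin (m + 2)) ∉ insert 0 W := by
    rw [mem_insert, not_or]
    exact ⟨by simp, fun h => by simpa using mem_powerset.1 hW h⟩
  have hWm := card_le_card (mem_powerset.1 hW)
  rw [hcard] at hWm
  have hins : (insert 0 W).card = W.card + 1 := card_insert_of_notMem h0
  have hcompl : (insert 0 W)ᶜ.card = m + 1 - W.card := by
    rw [card_compl, hins, Fintype.card_fin]
    omega
  have hsub : edgesIn (insert 0 W) ∪ edgesIn (insert 0 W)ᶜ ⊆
      (edgesIn univ).erase s((0 : Fin (m + 2)), 1) := by
    refine subset_erase.2 ⟨edgesIn_union_compl_subset _, fun h => ?_⟩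
    simp only [mem_union, mk_mem_edgesIn, mem_compl] at h
    rcases h with h | h
    · exact h1 h.2.1
    · exact h.1 (mem_insert_self _ _)
  rw [edgeSum_eq_mul (P₁ := fun A => Joins A (insert 0 W))
    (P₂ := fun A => Joins A (insert 0 W)ᶜ)
    (disjoint_edgesIn disjoint_compl_right) hsub,
    edgeSum_joins q (insert_nonempty _ _), edgeSum_joins q ⟨1, mem_compl.2 h1⟩]
  · rw [hins, hcompl]
    congr 2
    · rw [card_erase_of_mem (mk_mem_edgesIn.2 ⟨mem_univ _, mem_univ _, zero_ne_one⟩)]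
      simp only [card_edgesIn, hins, hcompl, card_univ, Fintype.card_fin]
      have := add_choose_two (W.card + 1) (m + 1 - W.card)
      rw [show W.card + 1 + (m + 1 - W.card) = m + 2 by omega] at this
      omega
  · exact fun A hA =>
      splits_component_eq_iff (mem_insert_self _ _) h1 (hA.trans (erase_subset _ _))

lemma connected_insert_iff {V : Type} [DecidableEq V] (A : Finset (Sym2 V)) {u v : V}
    (huv : u ≠ v) :
    (fromEdgeSet ((insert s(u, v) A : Finset (Sym2 V)) : Set (Sym2 V))).Connected ↔
      (fromEdgeSet (A : Set (Sym2 V))).Connected ∨ Splits A u v := by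
  have hmono : fromEdgeSet (A : Set (Sym2 V)) ≤
      fromEdgeSet ((insert s(u, v) A : Finset (Sym2 V)) : Set (Sym2 V)) :=
    fromEdgeSet_mono (coe_subset.2 (subset_insert _ _))
  constructor
  · intro h
    have hcover : ∀ w, (fromEdgeSet (A : Set (Sym2 V))).Reachable u w ∨
        (fromEdgeSet (A : Set (Sym2 V))).Reachable v w := by
      intro w
      have hw := (reachable_iff_reflTransGen u w).1 (h.preconnected u w)
      induction hw with
      | refl => exact Or.inl (Reachable.refl _)
      | tail _ hbc ih =>
        rw [fromEdgeSet_adj, mem_coe, mem_insert, Sym2.eq_iff] at hbc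
        rcases hbc with ⟨(⟨rfl, rfl⟩ | ⟨rfl, rfl⟩) | hm, hne⟩
        · exact Or.inr (Reachable.refl _)
        · exact Or.inl (Reachable.refl _)
        · have := Adj.reachable ((fromEdgeSet_adj (A : Set (Sym2 V))).2 ⟨hm, hne⟩)
          exact ih.imp (·.trans this) (·.trans this)
    by_cases hr : (fromEdgeSet (A : Set (Sym2 V))).Reachable u v
    · refine Or.inl ((connected_iff_exists_forall_reachable _).2 ⟨u, fun w => ?_⟩)
      exact (hcover w).elim id hr.trans
    · exact Or.inr ⟨hr, hcover⟩
  · rintro (h | h)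
    · exact h.mono hmono
    · refine (connected_iff_exists_forall_reachable _).2 ⟨u, fun w => ?_⟩
      refine (h.2 w).elim (·.mono hmono) fun hv => Reachable.trans ?_ (hv.mono hmono)
      exact Adj.reachable ((fromEdgeSet_adj _).2 ⟨by simp, huv⟩)

lemma Cfun_eq_Rfun_add (m : ℕ) (q : ℝ) :
    Cfun (m + 2) q = Rfun (m + 2) q + (1 - q) * Sfun (m + 2) q := by
  rw [Sfun_eq_edgeSum, Cfun, Rfun, relPoly_eq_edgeSum, relPoly_eq_edgeSum, edgeFin_top,
    edgeFin_Hgraph]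
  conv_lhs => rw [← insert_erase (mk_mem_edgesIn.2 (by simp) :
    s((0 : Fin (m + 2)), 1) ∈ edgesIn univ)]
  rw [edgeSum_insert (notMem_erase _ _),
    edgeSum_congr fun A _ => connected_insert_iff A (zero_ne_one' (Fin (m + 2))),
    edgeSum_or fun A h hs => hs.1 (h.preconnected _ _)]
  ring

lemma continuous_Cfun (n : ℕ) : Continuous (Cfun n) := by
  unfold Cfun
  simp only [relPoly_eq_edgeSum, edgeSum]
  fun_prop

/-- The sum of `b ^ |∂J|` over the nonempty proper subsets `J` of the vertices of `K_m`. -/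
def cutSum (b : ℝ) (m : ℕ) : ℝ := ∑ j ∈ Ico 1 m, (m.choose j : ℝ) * b ^ (j * (m - j))

lemma cutSum_nonneg {b : ℝ} (hb : 0 ≤ b) (m : ℕ) : 0 ≤ cutSum b m :=
  Finset.sum_nonneg fun _ _ => by positivity

lemma sum_range_succ_eq_add_Ico (f : ℕ → ℝ) {m : ℕ} (hm : 1 ≤ m) :
    ∑ j ∈ range (m + 1), f j = f 0 + f m + ∑ j ∈ Ico 1 m, f j := by
  rw [Finset.sum_range_succ, Finset.range_eq_Ico, Finset.sum_eq_sum_Ico_succ_bot (by omega)]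
  ring

lemma cutSum_sq_le {c : ℝ} (hc₀ : 0 ≤ c) (hc₁ : c ≤ 1) {m : ℕ} (hm : 1 ≤ m) :
    cutSum (c ^ 2) m ≤ 2 * (Real.exp (m * c ^ m) - 1) := by
  have hx : 0 ≤ c ^ m := by positivity
  have hterm : ∀ j ∈ Ico 1 m, (m.choose j : ℝ) * (c ^ 2) ^ (j * (m - j)) ≤
      (m.choose j : ℝ) * ((c ^ m) ^ j + (c ^ m) ^ (m - j)) := by
    intro j hj
    rw [mem_Ico] at hj
    refine mul_le_mul_of_nonneg_left ?_ (by positivity)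
    rw [← pow_mul, ← pow_mul, ← pow_mul]
    have h₁ : 0 ≤ c ^ (m * j) := by positivity
    have h₂ : 0 ≤ c ^ (m * (m - j)) := by positivity
    obtain ⟨i, rfl⟩ := Nat.exists_eq_add_of_le hj.2.le
    rw [Nat.add_sub_cancel_left] at h₂ ⊢
    rcases le_total j i with h | h
    · have : c ^ (2 * (j * i)) ≤ c ^ ((j + i) * j) :=
        pow_le_pow_of_le_one hc₀ hc₁ (by nlinarith)
      linarith
    · have : c ^ (2 * (j * i)) ≤ c ^ ((j + i) * i) :=
        pow_le_pow_of_le_one hc₀ hc₁ (by nlinarith)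
      linarith
  have htotal : ∑ j ∈ range (m + 1), (m.choose j : ℝ) * ((c ^ m) ^ j + (c ^ m) ^ (m - j)) =
      2 * (1 + c ^ m) ^ m := by
    have h₁ := add_pow (c ^ m) 1 m
    have h₂ := add_pow 1 (c ^ m) m
    simp only [one_pow, mul_one, one_mul] at h₁ h₂
    simp only [mul_add, Finset.sum_add_distrib]
    rw [two_mul]
    nth_rw 1 [add_comm 1 (c ^ m)]
    rw [h₁, h₂]
    simp only [mul_comm]
  rw [sum_range_succ_eq_add_Ico _ hm] at htotal
  have hexp : (1 + c ^ m) ^ m ≤ Real.exp (m * c ^ m) := by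
    rw [Real.exp_nat_mul]
    exact pow_le_pow_left₀ (by positivity) (by linarith [Real.add_one_le_exp (c ^ m)]) m
  have hpow : 0 ≤ (c ^ m) ^ m := by positivity
  simp only [Nat.choose_zero_right, Nat.choose_self, Nat.cast_one, one_mul, pow_zero,
    Nat.sub_zero, Nat.sub_self] at htotal
  have := Finset.sum_le_sum hterm
  unfold cutSum
  linarith

lemma tendsto_cutSum {b : ℝ} (hb₀ : 0 ≤ b) (hb₁ : b < 1) :
    Filter.Tendsto (cutSum b) Filter.atTop (nhds 0) := by
  have hc₁ : √b < 1 := by rwa [Real.sqrt_lt' one_pos, one_pow]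
  have hlim := tendsto_self_mul_const_pow_of_lt_one (Real.sqrt_nonneg b) hc₁
  have hlim' : Filter.Tendsto (fun m : ℕ => 2 * (Real.exp (m * √b ^ m) - 1))
      Filter.atTop (nhds 0) := by
    simpa using (((Real.continuous_exp.tendsto 0).comp hlim).sub_const 1).const_mul 2
  refine tendsto_of_tendsto_of_tendsto_of_le_of_le' tendsto_const_nhds hlim'
    (Filter.Eventually.of_forall (cutSum_nonneg hb₀)) ?_
  filter_upwards [Filter.eventually_ge_atTop 1] with m hm
  simpa only [Real.sq_sqrt hb₀] using cutSum_sq_le (Real.sqrt_nonneg b) hc₁.le hm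

lemma abs_Cfun_sub_one_le {b M q : ℝ} {m : ℕ} (hq : |q| ≤ b)
    (hM : ∀ k ≤ m, |Cfun k q| ≤ M) : |Cfun (m + 1) q - 1| ≤ M * cutSum b (m + 1) := by
  have h := sum_choose_mul_Cfun m q
  rw [Finset.sum_range_succ, Nat.choose_self, Nat.sub_self, mul_zero, pow_zero, mul_one,
    Nat.cast_one, one_mul] at h
  rw [← h, sub_add_cancel_right, abs_neg, cutSum, Finset.sum_Ico_eq_sum_range, mul_sum,
    Nat.add_sub_cancel]
  refine (Finset.abs_sum_le_sum_abs _ _).trans (Finset.sum_le_sum fun j hj => ?_)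
  rw [mem_range] at hj
  have hM₀ : 0 ≤ M := (abs_nonneg _).trans (hM (j + 1) hj)
  rw [abs_mul, abs_mul, abs_pow, Nat.abs_cast, show m + 1 - (1 + j) = m - j by omega,
    add_comm 1 j]
  have hch : (m.choose j : ℝ) ≤ ((m + 1).choose (j + 1) : ℕ) := by
    rw [Nat.choose_succ_succ']
    exact_mod_cast Nat.le_add_right _ _
  calc (m.choose j : ℝ) * (|Cfun (j + 1) q| * |q| ^ ((j + 1) * (m - j)))
      ≤ ((m + 1).choose (j + 1) : ℕ) * (M * b ^ ((j + 1) * (m - j))) := by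
        gcongr
        exact hM (j + 1) hj
    _ = M * (((m + 1).choose (j + 1) : ℕ) * b ^ ((j + 1) * (m - j))) := by ring

lemma exists_abs_Cfun_le {b : ℝ} (hb₀ : 0 ≤ b) (hb₁ : b < 1) :
    ∃ M, ∀ n q, |q| ≤ b → |Cfun n q| ≤ M := by
  have hbound : ∀ n, ∃ B, ∀ q, |q| ≤ b → |Cfun n q| ≤ B := by
    intro n
    obtain ⟨B, hB⟩ := (isCompact_Icc (a := -b) (b := b)).exists_bound_of_continuousOn
      (continuous_Cfun n).continuousOn
    exact ⟨B, fun q hq => hB q (abs_le.1 hq)⟩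
  choose B hB using hbound
  have hB₀ : ∀ n, 0 ≤ B n := fun n => (abs_nonneg _).trans (hB n 0 (by simpa))
  obtain ⟨n₀, hn₀⟩ := Filter.eventually_atTop.1
    ((tendsto_cutSum hb₀ hb₁).eventually_le_const (by norm_num : (0 : ℝ) < 1 / 2))
  have hsum : 0 ≤ ∑ k ∈ range (n₀ + 1), B k := Finset.sum_nonneg fun k _ => hB₀ k
  refine ⟨2 + ∑ k ∈ range (n₀ + 1), B k, fun n q hq => ?_⟩
  induction n using Nat.strong_induction_on with
  | _ n ih =>
    rcases Nat.lt_or_ge n (n₀ + 1) with hn | hn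
    · have := Finset.single_le_sum (fun k _ => hB₀ k) (mem_range.2 hn)
      linarith [hB n q hq]
    · obtain ⟨m, rfl⟩ : ∃ m, n = m + 1 := ⟨n - 1, by omega⟩
      have h := abs_Cfun_sub_one_le (m := m) hq fun k hk => ih k (by omega)
      have hT := hn₀ (m + 1) (by omega)
      have := abs_sub_abs_le_abs_sub (Cfun (m + 1) q) 1
      rw [abs_one] at this
      nlinarith

lemma Cfun_one (q : ℝ) : Cfun 1 q = 1 := by
  simpa using sum_choose_mul_Cfun 0 q

lemma Sfun_eq_pow_mul {m : ℕ} (hm : 1 ≤ m) (q : ℝ) :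
    Sfun (m + 2) q = q ^ m * (2 * Cfun (m + 1) q + ∑ j ∈ Ico 1 m,
      (m.choose j : ℝ) * (Cfun (j + 1) q * Cfun (m + 1 - j) q * q ^ (j * (m - j)))) := by
  rw [Sfun_eq_sum, sum_range_succ_eq_add_Ico _ hm, mul_add, mul_sum]
  congr 1
  · simp [Cfun_one]
    ring
  · refine Finset.sum_congr rfl fun j hj => ?_
    rw [mem_Ico] at hj
    obtain ⟨i, rfl⟩ := Nat.exists_eq_add_of_le hj.2.le
    rw [show (j + 1) * (j + i + 1 - j) - 1 = (j + i) + j * (j + i - j) by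
      rw [show j + i + 1 - j = i + 1 by omega, Nat.add_sub_cancel_left]
      ring_nf
      omega, pow_add]
    ring

lemma abs_sum_Cfun_mul_Cfun_le {b M q : ℝ} {m : ℕ} (hq : |q| ≤ b)
    (hM : ∀ k, |Cfun k q| ≤ M) :
    |∑ j ∈ Ico 1 m, (m.choose j : ℝ) *
      (Cfun (j + 1) q * Cfun (m + 1 - j) q * q ^ (j * (m - j)))| ≤ M ^ 2 * cutSum b m := by
  rw [cutSum, mul_sum]
  refine (Finset.abs_sum_le_sum_abs _ _).trans (Finset.sum_le_sum fun j _ => ?_)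
  have hM₀ : 0 ≤ M := (abs_nonneg _).trans (hM 0)
  rw [abs_mul, abs_mul, abs_mul, abs_pow, Nat.abs_cast]
  calc (m.choose j : ℝ) * (|Cfun (j + 1) q| * |Cfun (m + 1 - j) q| * |q| ^ (j * (m - j)))
      ≤ (m.choose j : ℝ) * (M * M * b ^ (j * (m - j))) := by
        gcongr
        · exact hM _
        · exact hM _
    _ = M ^ 2 * ((m.choose j : ℝ) * b ^ (j * (m - j))) := by ring

lemma exists_bound_of_subset_Ioo {K : Set ℝ} (hKc : IsCompact K)
    (hK : K ⊆ Set.Ioo (-1 : ℝ) 0) : ∃ b : ℝ, 0 ≤ b ∧ b < 1 ∧ ∀ q ∈ K, |q| ≤ b := by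
  rcases K.eq_empty_or_nonempty with rfl | hne
  · exact ⟨0, le_rfl, one_pos, by simp⟩
  · obtain ⟨x, hx, hmax⟩ := hKc.exists_isMaxOn hne continuous_abs.continuousOn
    exact ⟨|x|, abs_nonneg x, abs_lt.2 ⟨(hK hx).1, (hK hx).2.trans one_pos⟩,
      fun q hq => hmax hq⟩

/-- For every compact `K ⊂ (-1, 0)` there is an integer `N ≥ 3` such that on all of `K` the
split reliability `S_N` is nonzero and the virtual edge interaction satisfies `ŷ_N(q) < -1`. -/
theorem exists_yhat_lt_neg_one (K : Set ℝ) (hKc : IsCompact K)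
    (hK : K ⊆ Set.Ioo (-1 : ℝ) 0) :
    ∃ N : ℕ, 3 ≤ N ∧ ∀ q ∈ K, Sfun N q ≠ 0 ∧ yfun N q < -1 := by
  obtain ⟨b, hb₀, hb₁, hb⟩ := exists_bound_of_subset_Ioo hKc hK
  obtain ⟨M, hM⟩ := exists_abs_Cfun_le hb₀ hb₁
  have hT := tendsto_cutSum hb₀ hb₁
  have hev₁ := (hT.const_mul M).eventually_le_const
    (by norm_num : M * 0 < (1 / 4 : ℝ))
  have hev₂ := (hT.const_mul (M ^ 2)).eventually_le_const
    (by norm_num : M ^ 2 * 0 < (1 / 2 : ℝ))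
  have hev₃ := (tendsto_pow_atTop_nhds_zero_of_lt_one hb₀ hb₁).eventually_le_const
    (by norm_num : (0 : ℝ) < 1 / 8)
  obtain ⟨n, hn⟩ := Filter.eventually_atTop.1 (hev₁.and (hev₂.and hev₃))
  set m := 2 * n + 1 with hm
  refine ⟨m + 2, by omega, fun q hq => ?_⟩
  have hq₀ : q < 0 := (hK hq).2
  have hqb := hb q hq
  have hMq : ∀ k, |Cfun k q| ≤ M := fun k => hM k q hqb
  have hC₁ := abs_le.1 ((abs_Cfun_sub_one_le (m := m) hqb fun k _ => hMq k).trans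
    (hn (m + 1) (by omega)).1)
  have hC₂ := abs_le.1 ((abs_Cfun_sub_one_le (m := m + 1) hqb fun k _ => hMq k).trans
    (hn (m + 2) (by omega)).1)
  have hsum := abs_le.1 ((abs_sum_Cfun_mul_Cfun_le (m := m) hqb hMq).trans
    (hn m (by omega)).2.1)
  have hpow_neg : q ^ m < 0 := Odd.pow_neg ⟨n, hm⟩ hq₀
  have hpow : -(1 / 8) ≤ q ^ m := by
    have : |q ^ m| ≤ b ^ m := abs_pow q m ▸ pow_le_pow_left₀ (abs_nonneg q) hqb m
    exact (abs_le.1 (this.trans (hn m (by omega)).2.2)).1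
  have hS := Sfun_eq_pow_mul (m := m) (by omega) q
  have hS_neg : Sfun (m + 2) q < 0 := by
    rw [hS]
    exact mul_neg_of_neg_of_pos hpow_neg (by linarith)
  have hS_gt : -(1 / 2) < Sfun (m + 2) q := by
    rw [hS]
    nlinarith
  refine ⟨hS_neg.ne, ?_⟩
  have hR := Cfun_eq_Rfun_add m q
  have hlt : Rfun (m + 2) q / Sfun (m + 2) q < -2 := by
    rw [div_lt_iff_of_neg hS_neg]
    nlinarith
  rw [yfun]
  linarith

end
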